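/- Fix reals i, j ≥ 0 with i + j = 1. Then Bad(i,j) equals the intersection over all divergent approximating functions ψ of the sets V_{(i,j)}(ψ) := { irrational x : μ(W^x_{(i,j)}(ψ)) = 1 }. That is, an irrational vector x satisfies μ(W^x_{(i,j)}(ψ)) = 1 for every strictly positive non-increasing ψ with divergent sum if and only if x ∈ Bad(i,j). -/

import Mathlib

open MeasureTheory Set Filter

/-- Distance to the nearest integer. -/
noncomputable def nint (y : ℝ) : ℝ := |y - (round y : ℝ)|

/-- `pw y e = y ^ (1/e)`, with the convention that `y ^ (1/0) = 0`. -/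
noncomputable def pw (y e : ℝ) : ℝ := if e = 0 then 0 else y ^ (1 / e)

/-- A vector is irrational if `1, x₁, x₂` are linearly independent over `ℚ`. -/
def IrrVec (x : ℝ × ℝ) : Prop :=
  ∀ a b c : ℤ, (a : ℝ) * x.1 + (b : ℝ) * x.2 + (c : ℝ) = 0 → a = 0 ∧ b = 0 ∧ c = 0

/-- The set `Bad(i,j)` of `(i,j)`-badly approximable vectors. -/
def Badij (i j : ℝ) (x : ℝ × ℝ) : Prop :=
  IrrVec x ∧ ∃ c > (0 : ℝ), ∀ q : ℕ, 0 < q →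
    max (pw (nint (q * x.1)) i) (pw (nint (q * x.2)) j) > c / q

/-- The twisted well-approximable set `W^x_{(i,j)}(ψ)`. -/
def twistedW (x : ℝ × ℝ) (i j : ℝ) (ψ : ℕ → ℝ) : Set (ℝ × ℝ) :=
  {γ ∈ Set.Icc (0 : ℝ × ℝ) 1 |
    {q : ℤ | q ≠ 0 ∧
      max (pw (nint (q * x.1 - γ.1)) i) (pw (nint (q * x.2 - γ.2)) j)
        ≤ ψ q.natAbs}.Infinite}


/-- The two-dimensional torus. -/
abbrev TT := UnitAddTorus (Fin 2)

/-- The projection to the torus. -/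
noncomputable def toT (x : ℝ × ℝ) : TT := ![(x.1 : UnitAddCircle), (x.2 : UnitAddCircle)]

/-- The weighted box of size `ε`. -/
def box (e : Fin 2 → ℝ) (ε : ℝ) : Set TT := {g | ∀ k, ‖g k‖ ≤ ε ^ e k}

/-- The translated box. -/
def bx (e : Fin 2 → ℝ) (a : TT) (ε : ℝ) : Set TT := {g | a - g ∈ box e ε}

lemma norm_le_half (t : UnitAddCircle) : ‖t‖ ≤ 1 / 2 := by
  simpa using AddCircle.norm_le_half_period (p := (1 : ℝ)) (x := t) one_ne_zero

lemma pw_le_iff {y e ε : ℝ} (hy : 0 ≤ y) (hy' : y ≤ 1 / 2) (he : 0 ≤ e) (hε : 0 < ε) :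
    pw y e ≤ ε ↔ y ≤ ε ^ e := by
  unfold pw
  split_ifs with h
  · subst h; simp only [Real.rpow_zero]; constructor
    · intro _; linarith
    · intro _; exact hε.le
  · have he : 0 < e := lt_of_le_of_ne he (Ne.symm h)
    rw [one_div, Real.rpow_inv_le_iff_of_pos hy hε.le he]

lemma nint_eq (y : ℝ) : nint y = ‖(y : UnitAddCircle)‖ := by
  rw [UnitAddCircle.norm_eq]; rfl

lemma max_le_iff_box {i j : ℝ} (hi : 0 ≤ i) (hj : 0 ≤ j) {ε : ℝ} (hε : 0 < ε) (y z : ℝ) :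
    max (pw (nint y) i) (pw (nint z) j) ≤ ε ↔ toT (y, z) ∈ box ![i, j] ε := by
  rw [max_le_iff, nint_eq, nint_eq, pw_le_iff (norm_nonneg _) (norm_le_half _) hi hε,
    pw_le_iff (norm_nonneg _) (norm_le_half _) hj hε]
  simp [box, toT, Fin.forall_fin_two]

lemma toT_sub_zsmul (x γ : ℝ × ℝ) (q : ℤ) :
    toT (q * x.1 - γ.1, q * x.2 - γ.2) = q • toT x - toT γ := by
  funext k
  fin_cases k <;> simp [toT]

lemma toT_nsmul (x : ℝ × ℝ) (q : ℕ) :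
    toT (q * x.1, q * x.2) = q • toT x := by
  funext k
  fin_cases k <;> simp [toT]

lemma bx_eq_pi (e : Fin 2 → ℝ) (a : TT) (ε : ℝ) :
    bx e a ε = Set.pi univ (fun k => Metric.closedBall (a k) (ε ^ e k)) := by
  ext g
  simp [bx, box, Metric.mem_closedBall, dist_eq_norm, norm_sub_rev]

lemma measurableSet_bx (e : Fin 2 → ℝ) (a : TT) (ε : ℝ) : MeasurableSet (bx e a ε) := by
  rw [bx_eq_pi]
  exact MeasurableSet.univ_pi fun k => Metric.isClosed_closedBall.measurableSet

instance : IsProbabilityMeasure (volume : Measure UnitAddCircle) :=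
  ⟨UnitAddCircle.measure_univ⟩

lemma pi_ball_real (r : Fin 2 → ℝ) (hr : ∀ k, 0 ≤ r k) (a : TT) :
    (volume : Measure TT).real (Set.pi univ (fun k => Metric.closedBall (a k) (r k)))
      = min 1 (2 * r 0) * min 1 (2 * r 1) := by
  have h0 := hr 0
  have h1 := hr 1
  rw [Measure.real, volume_pi_pi, Fin.prod_univ_two, AddCircle.volume_closedBall,
    AddCircle.volume_closedBall, ENNReal.toReal_mul, ENNReal.toReal_ofReal,
    ENNReal.toReal_ofReal] <;> positivity

lemma bx_upper {e : Fin 2 → ℝ} (hsum : e 0 + e 1 = 1) (a : TT)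
    {ε : ℝ} (hε : 0 < ε) : (volume : Measure TT).real (bx e a ε) ≤ 4 * ε := by
  rw [bx_eq_pi, pi_ball_real _ (fun k => by positivity)]
  have : ε ^ e 0 * ε ^ e 1 = ε := by rw [← Real.rpow_add hε, hsum, Real.rpow_one]
  calc _ ≤ (2 * ε ^ e 0) * (2 * ε ^ e 1) := by gcongr <;> exact min_le_right _ _
    _ = 4 * ε := by linear_combination 4 * this

lemma bx_lower {e : Fin 2 → ℝ} (he : ∀ k, 0 ≤ e k) (hsum : e 0 + e 1 = 1) (a : TT)
    {ε : ℝ} (hε : 0 < ε) (hε1 : ε ≤ 1) : ε ≤ (volume : Measure TT).real (bx e a ε) := by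
  rw [bx_eq_pi, pi_ball_real _ (fun k => by positivity)]
  have : ε ^ e 0 * ε ^ e 1 = ε := by rw [← Real.rpow_add hε, hsum, Real.rpow_one]
  have h : ∀ k, ε ^ e k ≤ min 1 (2 * ε ^ e k) := fun k => by
    have h1 : ε ^ e k ≤ 1 := Real.rpow_le_one hε.le hε1 (he k)
    have h2 : 0 < ε ^ e k := by positivity
    exact le_min h1 (by linarith)
  calc ε = ε ^ e 0 * ε ^ e 1 := this.symm
    _ ≤ _ := by gcongr <;> exact h _

/-- Transfer of measures between the unit square and the torus. -/
lemma volume_transfer {U : Set TT} (hU : MeasurableSet U) :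
    volume (Set.Icc (0 : ℝ × ℝ) 1 ∩ toT ⁻¹' U) = volume U := by
  have h1 := UnitAddCircle.measurePreserving_mk 0
  have h2 := h1.prod h1
  have h3 := ((volume_preserving_finTwoArrow UnitAddCircle).symm).comp h2
  have h4 := h3.measure_preimage hU.nullMeasurableSet
  rw [← h4, Measure.prod_restrict]
  have hpre : (⇑(MeasurableEquiv.finTwoArrow (α := UnitAddCircle)).symm ∘
      Prod.map (fun t : ℝ => (t : UnitAddCircle)) (fun t : ℝ => (t : UnitAddCircle))) ⁻¹' U
      = toT ⁻¹' U := rfl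
  rw [hpre]
  have hm : Measurable toT := h3.measurable
  rw [Measure.restrict_apply (hm hU), Set.inter_comm]
  apply measure_congr
  refine Filter.EventuallyEq.inter (Filter.EventuallyEq.refl _ _) ?_
  have : (Set.Icc (0 : ℝ × ℝ) 1) = Set.Icc (0:ℝ) 1 ×ˢ Set.Icc (0:ℝ) 1 := by
    rw [Set.Icc_prod_Icc]; rfl
  rw [this, zero_add]
  exact (Measure.set_prod_ae_eq Ioc_ae_eq_Icc Ioc_ae_eq_Icc).symm

/-- Chung–Erdős type inequality. -/
lemma chung_erdos {α : Type*} [MeasurableSpace α] (μ : Measure α) [IsProbabilityMeasure μ]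
    (I : Finset ℕ) (B : ℕ → Set α) (hB : ∀ q, MeasurableSet (B q)) (D : ℝ) (hD : 0 < D)
    (hS : 0 < ∑ q ∈ I, μ.real (B q))
    (hP : ∑ q ∈ I, ∑ r ∈ I, μ.real (B q ∩ B r) ≤ D * (∑ q ∈ I, μ.real (B q)) ^ 2) :
    1 / D ≤ μ.real (⋃ q ∈ I, B q) := by
  set S := ∑ q ∈ I, μ.real (B q) with hSdef
  set U := ⋃ q ∈ I, B q with hU
  have hUm : MeasurableSet U := I.measurableSet_biUnion fun q _ => hB q
  have hintg : ∀ s : Set α, MeasurableSet s → Integrable (s.indicator (fun _ => (1:ℝ))) μ :=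
    fun s hs => (integrable_const 1).indicator hs
  have key : ∀ t : ℝ, 0 ≤ t ^ 2 * (∑ q ∈ I, ∑ r ∈ I, μ.real (B q ∩ B r)) - 2 * t * S
      + μ.real U := by
    intro t
    have hval : ∫ x, (t ^ 2 * (∑ q ∈ I, ∑ r ∈ I, (B q ∩ B r).indicator (fun _ => (1:ℝ)) x)
        - 2 * t * (∑ q ∈ I, (B q).indicator (fun _ => (1:ℝ)) x)
        + U.indicator (fun _ => (1:ℝ)) x) ∂μ = t ^ 2 * (∑ q ∈ I, ∑ r ∈ I, μ.real (B q ∩ B r))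
        - 2 * t * S + μ.real U := by
      have i1 : ∀ q r, Integrable ((B q ∩ B r).indicator (fun _ => (1:ℝ))) μ :=
        fun q r => hintg _ ((hB q).inter (hB r))
      have i2 : ∀ q, Integrable ((B q).indicator (fun _ => (1:ℝ))) μ := fun q => hintg _ (hB q)
      have j1 : Integrable (fun x => t ^ 2 *
          (∑ q ∈ I, ∑ r ∈ I, (B q ∩ B r).indicator (fun _ => (1:ℝ)) x)) μ :=
        (integrable_finsetSum _ fun q _ => integrable_finsetSum _ fun r _ => i1 q r).const_mul _
      have j2 : Integrable (fun x => 2 * t *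
          (∑ q ∈ I, (B q).indicator (fun _ => (1:ℝ)) x)) μ :=
        (integrable_finsetSum _ fun q _ => i2 q).const_mul _
      have j3 : Integrable (fun x => t ^ 2 *
          (∑ q ∈ I, ∑ r ∈ I, (B q ∩ B r).indicator (fun _ => (1:ℝ)) x) - 2 * t *
          (∑ q ∈ I, (B q).indicator (fun _ => (1:ℝ)) x)) μ := j1.sub j2
      rw [integral_add j3 (hintg U hUm), integral_sub j1 j2, integral_const_mul,
        integral_const_mul, integral_finsetSum _ (fun q _ => integrable_finsetSum _ fun r _ => i1 q r),
        integral_finsetSum _ (fun q _ => i2 q), integral_indicator_const _ hUm]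
      congr 1
      · congr 1
        · congr 1
          refine Finset.sum_congr rfl fun q _ => ?_
          rw [integral_finsetSum _ (fun r _ => i1 q r)]
          refine Finset.sum_congr rfl fun r _ => ?_
          rw [integral_indicator_const _ ((hB q).inter (hB r))]; simp
        · congr 1
          refine Finset.sum_congr rfl fun q _ => ?_
          rw [integral_indicator_const _ (hB q)]; simp
      · simp
    rw [← hval]
    apply integral_nonneg
    intro x
    have e1 : ∑ q ∈ I, ∑ r ∈ I, (B q ∩ B r).indicator (fun _ => (1:ℝ)) x
        = (∑ q ∈ I, (B q).indicator (fun _ => (1:ℝ)) x) ^ 2 := by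
      rw [sq, Finset.sum_mul_sum]
      refine Finset.sum_congr rfl fun q _ => Finset.sum_congr rfl fun r _ => ?_
      by_cases h1 : x ∈ B q <;> by_cases h2 : x ∈ B r <;> simp [h1, h2]
    simp only [Pi.zero_apply]
    rw [e1]
    by_cases hx : x ∈ U
    · rw [Set.indicator_of_mem hx]
      nlinarith [sq_nonneg (t * (∑ q ∈ I, (B q).indicator (fun _ => (1:ℝ)) x) - 1)]
    · have : ∀ q ∈ I, (B q).indicator (fun _ => (1:ℝ)) x = 0 := by
        intro q hq
        apply Set.indicator_of_notMem
        intro h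
        exact hx (Set.mem_biUnion hq h)
      rw [Finset.sum_eq_zero this, Set.indicator_of_notMem hx]
      simp
  have := key (1 / (D * S))
  have h2 : (1 / (D * S)) ^ 2 * (∑ q ∈ I, ∑ r ∈ I, μ.real (B q ∩ B r))
      ≤ (1 / (D * S)) ^ 2 * (D * S ^ 2) := by gcongr
  have h3 : (1 / (D * S)) ^ 2 * (D * S ^ 2) = 1 / D := by field_simp
  have h4 : 2 * (1 / (D * S)) * S = 2 * (1 / D) := by field_simp
  linarith

/-- Sums of a monotone function over a separated set. -/
lemma sep_sum (ψ : ℕ → ℝ) (h0 : ∀ r, 0 ≤ ψ r) (hψ : Antitone ψ) (q N : ℕ) (A : Finset ℕ)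
    (hA : A ⊆ Finset.Ioc q N) (L : ℝ)
    (h1 : ∀ a ∈ A, L ≤ (a : ℝ) - q) (h2 : ∀ a ∈ A, ∀ b ∈ A, a < b → L ≤ (b : ℝ) - a) :
    L * ∑ a ∈ A, ψ a ≤ ∑ r ∈ Finset.Ioc q N, ψ r := by
  classical
  set l := ⌈L⌉₊ with hl
  have hLl : L ≤ l := Nat.le_ceil L
  have h1' : ∀ a ∈ A, q + l ≤ a := by
    intro a ha
    have := (Finset.mem_Ioc.1 (hA ha)).1
    have h := h1 a ha
    have : l ≤ a - q := Nat.ceil_le.2 (by rw [Nat.cast_sub this.le]; exact h)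
    omega
  have h2' : ∀ a ∈ A, ∀ b ∈ A, a < b → a + l ≤ b := by
    intro a ha b hb hab
    have h := h2 a ha b hb hab
    have : l ≤ b - a := Nat.ceil_le.2 (by rw [Nat.cast_sub hab.le]; exact h)
    omega
  have hdisj : (A : Set ℕ).PairwiseDisjoint (fun a => Finset.Ioc (a - l) a) := by
    intro a ha b hb hab
    show Disjoint _ _
    rw [Finset.disjoint_left]
    intro r hr hr'
    rw [Finset.mem_Ioc] at hr hr'
    rcases lt_or_gt_of_ne hab with h | h
    · have := h2' a ha b hb h; omega
    · have := h2' b hb a ha h; omega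
  calc L * ∑ a ∈ A, ψ a = ∑ a ∈ A, L * ψ a := Finset.mul_sum _ _ _
    _ ≤ ∑ a ∈ A, ∑ r ∈ Finset.Ioc (a - l) a, ψ r := by
        refine Finset.sum_le_sum fun a ha => ?_
        have hal := h1' a ha
        calc L * ψ a ≤ (l : ℝ) * ψ a := mul_le_mul_of_nonneg_right hLl (h0 a)
          _ = ∑ r ∈ Finset.Ioc (a - l) a, ψ a := by
            rw [Finset.sum_const, Nat.card_Ioc, nsmul_eq_mul]
            congr 2; omega
          _ ≤ _ := Finset.sum_le_sum fun r hr => hψ (Finset.mem_Ioc.1 hr).2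
    _ = ∑ r ∈ A.biUnion (fun a => Finset.Ioc (a - l) a), ψ r :=
        (Finset.sum_biUnion hdisj).symm
    _ ≤ _ := by
        apply Finset.sum_le_sum_of_subset_of_nonneg
        · intro r hr
          rw [Finset.mem_biUnion] at hr
          obtain ⟨a, ha, hr⟩ := hr
          have := h1' a ha
          have h3 := Finset.mem_Ioc.1 (hA ha)
          rw [Finset.mem_Ioc] at hr ⊢
          omega
        · intro r _ _; exact h0 r

lemma mFourier_add_arg (n : Fin 2 → ℤ) (a b : TT) :
    UnitAddTorus.mFourier n (a + b) = UnitAddTorus.mFourier n a * UnitAddTorus.mFourier n b := by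
  simp only [UnitAddTorus.mFourier, ContinuousMap.coe_mk, ← Finset.prod_mul_distrib]
  refine Finset.prod_congr rfl fun k _ => ?_
  simp [fourier_apply, AddCircle.toCircle_add, smul_add]

lemma mFourier_ne_one {x : ℝ × ℝ} (hirr : IrrVec x) {n : Fin 2 → ℤ} (hn : n ≠ 0) :
    UnitAddTorus.mFourier n (toT x) ≠ 1 := by
  intro h
  simp only [UnitAddTorus.mFourier, ContinuousMap.coe_mk, Fin.prod_univ_two, toT,
    Matrix.cons_val_zero, Matrix.cons_val_one, fourier_coe_apply] at h
  rw [← Complex.exp_add, Complex.exp_eq_one_iff] at h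
  obtain ⟨m, hm⟩ := h
  have h2 : (2 * Real.pi * Complex.I : ℂ) ≠ 0 := Complex.two_pi_I_ne_zero
  have h3 : ((n 0 : ℂ) * x.1 + n 1 * x.2 + ((-m : ℤ) : ℂ)) = 0 := by
    apply mul_left_cancel₀ h2
    push_cast at hm ⊢
    linear_combination hm
  have h4 : ((n 0 : ℝ) * x.1 + n 1 * x.2 + ((-m : ℤ) : ℝ)) = 0 := by exact_mod_cast h3
  obtain ⟨h0, h1, _⟩ := hirr _ _ _ h4
  apply hn
  funext k
  fin_cases k <;> simpa

lemma continuous_int (ν : Measure TT) [IsFiniteMeasure ν] :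
    Continuous (fun f : C(TT, ℂ) => ∫ g, f g ∂ν) := by
  have h : (fun f : C(TT, ℂ) => ∫ g, f g ∂ν) =
      fun f : C(TT, ℂ) => ∫ g, (ContinuousMap.toLp (E := ℂ) 1 ν ℂ f) g ∂ν := by
    funext f
    exact integral_congr_ae (ContinuousMap.coeFn_toLp ν f).symm
  rw [h]
  exact continuous_integral.comp (ContinuousMap.toLp (E := ℂ) 1 ν ℂ).continuous

lemma continuousMap_integrable (ν : Measure TT) [IsFiniteMeasure ν] (f : C(TT, ℂ)) :
    Integrable (fun g => f g) ν :=
  Integrable.of_bound f.continuous.aestronglyMeasurable ‖f‖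
    (Eventually.of_forall fun g => f.norm_coe_le_norm g)

lemma measure_eq_of_mFourier (ν₁ ν₂ : Measure TT) [IsFiniteMeasure ν₁] [IsFiniteMeasure ν₂]
    (h : ∀ n, ∫ g, UnitAddTorus.mFourier n g ∂ν₁ = ∫ g, UnitAddTorus.mFourier n g ∂ν₂) :
    ν₁ = ν₂ := by
  have hall : ∀ f : C(TT, ℂ), ∫ g, f g ∂ν₁ = ∫ g, f g ∂ν₂ := by
    intro f
    have hf : f ∈ (Submodule.span ℂ
        (range (UnitAddTorus.mFourier (d := Fin 2)))).topologicalClosure := by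
      rw [UnitAddTorus.span_mFourier_closure_eq_top]; trivial
    have hcl : IsClosed {f : C(TT, ℂ) | ∫ g, f g ∂ν₁ = ∫ g, f g ∂ν₂} :=
      isClosed_eq (continuous_int ν₁) (continuous_int ν₂)
    refine closure_minimal ?_ hcl hf
    intro f hf
    induction hf using Submodule.span_induction with
    | mem f hf => obtain ⟨n, rfl⟩ := hf; exact h n
    | zero => simp
    | add f₁ f₂ _ _ h₁ h₂ =>
      simp only [Set.mem_setOf_eq, ContinuousMap.add_apply] at *
      rw [integral_add (continuousMap_integrable _ _) (continuousMap_integrable _ _),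
        integral_add (continuousMap_integrable _ _) (continuousMap_integrable _ _), h₁, h₂]
    | smul c f _ h₁ =>
      simp only [Set.mem_setOf_eq, ContinuousMap.smul_apply] at *
      rw [integral_smul, integral_smul, h₁]
  apply ext_of_forall_integral_eq_of_IsFiniteMeasure
  intro f
  have := hall ⟨fun g => (f g : ℂ), by fun_prop⟩
  simp only [ContinuousMap.coe_mk] at this
  rw [integral_complex_ofReal, integral_complex_ofReal] at this
  exact_mod_cast this

lemma torus_ergodic {x : ℝ × ℝ} (hirr : IrrVec x) :
    Ergodic (fun g : TT => toT x + g) (volume : Measure TT) := by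
  have hmp : MeasurePreserving (fun g : TT => toT x + g) volume volume :=
    measurePreserving_add_left volume (toT x)
  refine { hmp with aeconst_set := ?_ }
  intro s hs hinv
  have hz : ∀ n : Fin 2 → ℤ, n ≠ 0 → ∀ t : Set TT, (fun g : TT => toT x + g) ⁻¹' t = t →
      ∫ g in t, UnitAddTorus.mFourier n g = 0 := by
    intro n hn t ht
    have h1 := hmp.setIntegral_preimage_emb (MeasurableEquiv.addLeft (toT x)).measurableEmbedding
      (fun g => UnitAddTorus.mFourier n g) t
    rw [ht] at h1
    simp only [mFourier_add_arg] at h1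
    rw [integral_const_mul] at h1
    have h2 := mFourier_ne_one hirr hn
    have h3 : (UnitAddTorus.mFourier n (toT x) - 1) *
        ∫ g in t, UnitAddTorus.mFourier n g = 0 := by linear_combination h1
    rcases mul_eq_zero.1 h3 with h | h
    · exact absurd (sub_eq_zero.1 h) h2
    · exact h
  have hν : (volume : Measure TT).restrict s = (volume s) • (volume : Measure TT) := by
    haveI : IsFiniteMeasure ((volume s) • (volume : Measure TT)) :=
      Measure.smul_finite _ (measure_ne_top _ _)
    apply measure_eq_of_mFourier
    intro n
    rw [integral_smul_measure]
    by_cases hn : n = 0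
    · subst hn
      simp [UnitAddTorus.mFourier_zero, Measure.real]
    · rw [hz n hn s hinv]
      have := hz n hn univ rfl
      rw [Measure.restrict_univ] at this
      rw [this, smul_zero]
  have h0 : volume s * volume sᶜ = (0 : ENNReal) := by
    have := congrArg (fun m : Measure TT => m sᶜ) hν
    simp only [Measure.smul_apply, smul_eq_mul] at this
    rw [← this, Measure.restrict_apply hs.compl]
    simp
  rw [eventuallyConst_set']
  rcases mul_eq_zero.1 h0 with h | h
  · left; exact ae_eq_empty.2 h
  · right; exact ae_eq_univ.2 h

lemma exists_K (e : Fin 2 → ℝ) : ∃ K : ℝ, 1 ≤ K ∧ ∀ k, 0 < e k → 2 ≤ K ^ e k := by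
  have h : ∀ᶠ K : ℝ in atTop, ∀ k, 0 < e k → 2 ≤ K ^ e k := by
    rw [eventually_all]
    intro k
    by_cases hk : 0 < e k
    · filter_upwards [(tendsto_rpow_atTop hk).eventually_ge_atTop 2] with K hK _ using hK
    · exact Eventually.of_forall fun K h => absurd h hk
  obtain ⟨K, h1, h2⟩ := ((eventually_ge_atTop 1).and h).exists
  exact ⟨K, h1, h2⟩

lemma box_sub {e : Fin 2 → ℝ} (he : ∀ k, 0 ≤ e k) {K : ℝ} (hK1 : 1 ≤ K)
    (hK : ∀ k, 0 < e k → 2 ≤ K ^ e k) {ε ε' : ℝ} (hε : 0 < ε) (hε' : 0 < ε') (hle : ε' ≤ ε)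
    {u v : TT} (hu : u ∈ box e ε) (hv : v ∈ box e ε') : u - v ∈ box e (K * ε) := by
  intro k
  rcases (he k).eq_or_lt with h | h
  · rw [← h, Real.rpow_zero]
    linarith [norm_le_half ((u - v) k)]
  · rw [Real.mul_rpow (by linarith) hε.le]
    have h1 := hu k
    have h2 := hv k
    have h3 : ε' ^ e k ≤ ε ^ e k := Real.rpow_le_rpow hε'.le hle h.le
    have h4 : 0 < ε ^ e k := by positivity
    have h5 := hK k h
    calc ‖(u - v) k‖ ≤ ‖u k‖ + ‖v k‖ := norm_sub_le _ _
      _ ≤ 2 * ε ^ e k := by linarith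
      _ ≤ _ := by gcongr

lemma box_neg {e : Fin 2 → ℝ} {ε : ℝ} {u : TT} (hu : u ∈ box e ε) : -u ∈ box e ε := by
  intro k; simpa using hu k

/-- uniform lower bound for the measure of tail unions -/
lemma tail_lower {e : Fin 2 → ℝ} (he : ∀ k, 0 ≤ e k) (hsum : e 0 + e 1 = 1) (X : TT)
    {c : ℝ} (hc : 0 < c) (hbad : ∀ q : ℕ, 0 < q → q • X ∉ box e (c / q)) :
    ∃ κ : ℝ, 0 < κ ∧ ∀ ψ : ℕ → ℝ, (∀ r, 0 < ψ r) → (∀ r, ψ r ≤ 1) → Antitone ψ →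
      ∀ M N : ℕ, 1 ≤ ∑ q ∈ Finset.Ioc M N, ψ q →
      κ ≤ (volume : Measure TT).real (⋃ q ∈ Finset.Ioc M N, bx e (q • X) (ψ q)) := by
  classical
  obtain ⟨K, hK1, hK⟩ := exists_K e
  have hK0 : 0 < K := by linarith
  set C := 4 * (K * K / c) with hC
  have hC0 : 0 < C := by positivity
  have hbad' : ∀ q : ℕ, 0 < q → ∀ ε : ℝ, 0 < ε → q • X ∈ box e ε → c / ε ≤ q := by
    intro q hq ε hε h
    by_contra! hlt
    apply hbad q hq
    have hq' : (0:ℝ) < q := by exact_mod_cast hq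
    have : ε ≤ c / q := by
      rw [lt_div_iff₀ hε] at hlt
      rw [le_div_iff₀ hq']; linarith
    intro k
    exact (h k).trans (Real.rpow_le_rpow hε.le this (he k))
  refine ⟨1 / (2 * C + 4), by positivity, ?_⟩
  intro ψ hψ hψ1 hanti M N hs
  set I := Finset.Ioc M N with hI
  set s := ∑ q ∈ I, ψ q with hsdef
  let a : ℕ → ℕ → ℝ := fun q r => if q < r ∧ (r - q) • X ∈ box e (K * ψ q) then 4 * ψ r else 0
  have ha0 : ∀ q r, 0 ≤ a q r := fun q r => by
    have := hψ r
    simp only [a]; split_ifs <;> linarith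
  have hsS : s ≤ ∑ q ∈ I, (volume : Measure TT).real (bx e (q • X) (ψ q)) :=
    Finset.sum_le_sum fun q _ => bx_lower he hsum _ (hψ q) (hψ1 q)
  have hlt : ∀ q r, q < r → (volume : Measure TT).real (bx e (q • X) (ψ q) ∩ bx e (r • X) (ψ r))
      ≤ a q r := by
    intro q r hqr
    by_cases hne : (bx e (q • X) (ψ q) ∩ bx e (r • X) (ψ r)).Nonempty
    · obtain ⟨g, hg1, hg2⟩ := hne
      have h1 : q • X - g ∈ box e (ψ q) := hg1
      have h2 : r • X - g ∈ box e (ψ r) := hg2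
      have h3 := box_neg (box_sub he hK1 hK (hψ q) (hψ r) (hanti hqr.le) h1 h2)
      have h4 : -(q • X - g - (r • X - g)) = (r - q) • X := by
        rw [sub_nsmul _ hqr.le]; abel
      rw [h4] at h3
      simp only [a, hqr, h3, and_self, if_true]
      exact (measureReal_mono inter_subset_right).trans (bx_upper hsum _ (hψ r))
    · rw [Set.not_nonempty_iff_eq_empty] at hne
      rw [hne, measureReal_empty]; exact ha0 q r
  have hrow : ∀ q ∈ I, ∑ r ∈ I, a q r ≤ C * ψ q * s := by
    intro q hq
    set A := I.filter (fun r => q < r ∧ (r - q) • X ∈ box e (K * ψ q)) with hA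
    have e1 : ∑ r ∈ I, a q r = 4 * ∑ r ∈ A, ψ r := by
      rw [hA, Finset.mul_sum, Finset.sum_filter]
    have hψq := hψ q
    set L := c / (K * (K * ψ q)) with hL
    have hL0 : 0 < L := by positivity
    have hsep := sep_sum ψ (fun r => (hψ r).le) hanti q N A ?_ L ?_ ?_
    · have h5 : ∑ r ∈ Finset.Ioc q N, ψ r ≤ s := by
        apply Finset.sum_le_sum_of_subset_of_nonneg
        · intro r hr
          rw [hI, Finset.mem_Ioc] at *
          omega
        · intro r _ _; exact (hψ r).le
      have h6 : L * ∑ r ∈ A, ψ r ≤ s := hsep.trans h5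
      have h7 : ∑ r ∈ A, ψ r ≤ s / L := by rw [le_div_iff₀ hL0]; linarith
      have h8 : s / L = K * K / c * ψ q * s := by rw [hL]; field_simp
      rw [e1, hC]
      calc 4 * ∑ r ∈ A, ψ r ≤ 4 * (s / L) := by gcongr
        _ = _ := by rw [h8]; ring
    · intro r hr
      rw [hA, Finset.mem_filter, hI, Finset.mem_Ioc] at hr
      rw [Finset.mem_Ioc]; omega
    · intro r hr
      rw [hA, Finset.mem_filter] at hr
      obtain ⟨_, hqr, hr⟩ := hr
      have := hbad' (r - q) (by omega) _ (by positivity) hr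
      rw [Nat.cast_sub hqr.le] at this
      refine le_trans ?_ this
      rw [hL]
      apply div_le_div_of_nonneg_left hc.le (by positivity)
      have : 0 < K * ψ q := by positivity
      nlinarith
    · intro r hr r' hr' hrr
      rw [hA, Finset.mem_filter] at hr hr'
      obtain ⟨_, hqr, hr⟩ := hr
      obtain ⟨_, hqr', hr'⟩ := hr'
      have h3 := box_sub he hK1 hK (by positivity) (by positivity) le_rfl hr' hr
      have h4 : (r' - q) • X - (r - q) • X = (r' - r) • X := by
        have h5 : r' - q = (r' - r) + (r - q) := by omega
        rw [h5, add_nsmul]; abel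
      rw [h4] at h3
      have := hbad' (r' - r) (by omega) _ (by positivity) h3
      rwa [Nat.cast_sub hrr.le] at this
  have hpair : ∀ q r, (volume : Measure TT).real (bx e (q • X) (ψ q) ∩ bx e (r • X) (ψ r))
      ≤ a q r + a r q + (if q = r then 4 * ψ q else 0) := by
    intro q r
    have h1 := ha0 q r
    have h2 := ha0 r q
    have hq := hψ q
    rcases lt_trichotomy q r with h | h | h
    · have := hlt q r h
      rw [if_neg h.ne]; linarith
    · subst h
      rw [Set.inter_self, if_pos rfl]
      have := bx_upper hsum (q • X) (hψ q)
      linarith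
    · have := hlt r q h
      rw [Set.inter_comm] at this
      rw [if_neg h.ne']; linarith
  refine chung_erdos volume I (fun q => bx e (q • X) (ψ q))
    (fun q => measurableSet_bx _ _ _) (2 * C + 4) (by positivity) (by linarith) ?_
  have hdouble : ∑ q ∈ I, ∑ r ∈ I, a q r ≤ C * s * s := by
    calc _ ≤ ∑ q ∈ I, C * ψ q * s := Finset.sum_le_sum hrow
      _ = C * s * s := by rw [← Finset.sum_mul, ← Finset.mul_sum]
  calc ∑ q ∈ I, ∑ r ∈ I, (volume : Measure TT).real (bx e (q • X) (ψ q) ∩ bx e (r • X) (ψ r))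
      ≤ ∑ q ∈ I, ∑ r ∈ I, (a q r + a r q + (if q = r then 4 * ψ q else 0)) :=
        Finset.sum_le_sum fun q _ => Finset.sum_le_sum fun r _ => hpair q r
    _ = ∑ q ∈ I, ∑ r ∈ I, a q r + ∑ q ∈ I, ∑ r ∈ I, a r q + 4 * s := by
        simp only [Finset.sum_add_distrib]
        congr 1
        rw [hsdef, Finset.mul_sum]
        refine Finset.sum_congr rfl fun q hq => ?_
        rw [Finset.sum_ite_eq, if_pos hq]
    _ = 2 * (∑ q ∈ I, ∑ r ∈ I, a q r) + 4 * s := by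
        rw [Finset.sum_comm (f := fun q r => a r q)]; ring
    _ ≤ 2 * (C * s * s) + 4 * s := by linarith
    _ ≤ (2 * C + 4) * s ^ 2 := by nlinarith
    _ ≤ _ := by gcongr

lemma limsup_full {e : Fin 2 → ℝ} (he : ∀ k, 0 ≤ e k) (hsum : e 0 + e 1 = 1) {x : ℝ × ℝ}
    (hirr : IrrVec x)
    {c : ℝ} (hc : 0 < c) (hbad : ∀ q : ℕ, 0 < q → q • toT x ∉ box e (c / q))
    (ψ : ℕ → ℝ) (hψ : ∀ r, 0 < ψ r) (hψ1 : ∀ r, ψ r ≤ 1) (hanti : Antitone ψ)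
    (hdiv : ¬ Summable ψ) :
    MeasurableSet (⋂ M : ℕ, ⋃ q ∈ Set.Ioi M, bx e (q • toT x) (ψ q)) ∧
    volume (⋂ M : ℕ, ⋃ q ∈ Set.Ioi M, bx e (q • toT x) (ψ q)) = 1 := by
  set V : ℕ → Set TT := fun M => ⋃ q ∈ Set.Ioi M, bx e (q • toT x) (ψ q) with hV
  have hVm : ∀ M, MeasurableSet (V M) := fun M =>
    MeasurableSet.biUnion (Set.to_countable _) fun q _ => measurableSet_bx _ _ _
  have hWm : MeasurableSet (⋂ M, V M) := MeasurableSet.iInter hVm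
  refine ⟨hWm, ?_⟩
  obtain ⟨κ, hκ, hlow⟩ := tail_lower he hsum (toT x) hc hbad
  have hVlow : ∀ M, ENNReal.ofReal κ ≤ volume (V M) := by
    intro M
    have htend := (not_summable_iff_tendsto_nat_atTop_of_nonneg (fun r => (hψ r).le)).1 hdiv
    obtain ⟨N, hN1, hN2⟩ := ((htend.eventually_ge_atTop
      (1 + ∑ q ∈ Finset.range (M + 1), ψ q)).and (eventually_ge_atTop (M + 1))).exists
    have h1 : 1 ≤ ∑ q ∈ Finset.Ioc M N, ψ q := by
      have h2 := Finset.sum_range_add_sum_Ico ψ hN2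
      have h3 : ∑ q ∈ Finset.Ico (M + 1) N, ψ q ≤ ∑ q ∈ Finset.Ioc M N, ψ q := by
        apply Finset.sum_le_sum_of_subset_of_nonneg
        · intro r hr
          rw [Finset.mem_Ico] at hr
          rw [Finset.mem_Ioc]; omega
        · intro r _ _; exact (hψ r).le
      linarith
    have h2 := hlow ψ hψ hψ1 hanti M N h1
    calc ENNReal.ofReal κ ≤ ENNReal.ofReal
          ((volume : Measure TT).real (⋃ q ∈ Finset.Ioc M N, bx e (q • toT x) (ψ q))) :=
          ENNReal.ofReal_le_ofReal h2
      _ = volume (⋃ q ∈ Finset.Ioc M N, bx e (q • toT x) (ψ q)) := by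
          rw [Measure.real, ENNReal.ofReal_toReal (measure_ne_top _ _)]
      _ ≤ volume (V M) := by
          apply measure_mono
          apply Set.iUnion₂_subset
          intro q hq
          exact Set.subset_biUnion_of_mem (u := fun q => bx e (q • toT x) (ψ q))
            (Set.mem_Ioi.2 (Finset.mem_Ioc.1 hq).1)
  have hVanti : Antitone V := by
    intro M M' h
    exact Set.biUnion_subset_biUnion_left (Set.Ioi_subset_Ioi h)
  have hWlow : ENNReal.ofReal κ ≤ volume (⋂ M, V M) := by
    rw [hVanti.measure_iInter (fun M => (hVm M).nullMeasurableSet) ⟨0, measure_ne_top _ _⟩]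
    exact le_iInf hVlow
  have hpos : volume (⋂ M, V M) ≠ 0 := by
    intro h
    rw [h] at hWlow
    have := ENNReal.ofReal_pos.2 hκ
    exact absurd hWlow (not_le.2 this)
  have hsub : (fun g : TT => toT x + g) ⁻¹' (⋂ M, V M) ⊆ ⋂ M, V M := by
    intro g hg
    simp only [hV, Set.mem_preimage, Set.mem_iInter, Set.mem_iUnion, Set.mem_Ioi] at hg ⊢
    intro M
    obtain ⟨q, hq, hg⟩ := hg (M + 1)
    obtain ⟨p, rfl⟩ : ∃ p, q = p + 1 := ⟨q - 1, by omega⟩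
    refine ⟨p, by omega, ?_⟩
    have h1 : (p + 1) • toT x - (toT x + g) ∈ box e (ψ (p + 1)) := hg
    have h2 : (p + 1) • toT x - (toT x + g) = p • toT x - g := by
      rw [add_nsmul, one_nsmul]; abel
    rw [h2] at h1
    show p • toT x - g ∈ box e (ψ p)
    intro k
    exact (h1 k).trans (Real.rpow_le_rpow (hψ _).le (hanti (Nat.le_succ p)) (he k))
  rcases (torus_ergodic hirr).ae_empty_or_univ_of_preimage_ae_le' hWm.nullMeasurableSet
    hsub.eventuallyLE (measure_ne_top _ _) with h | h
  · exact absurd (ae_eq_empty.1 h) hpos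
  · rw [measure_congr h, measure_univ]

lemma dir1 {i j : ℝ} (hi : 0 ≤ i) (hj : 0 ≤ j) (hij : i + j = 1)
    {x : ℝ × ℝ} (hbad : Badij i j x) (ψ : ℕ → ℝ) (hψ : ∀ r, 0 < ψ r) (hanti : Antitone ψ)
    (hdiv : ¬ Summable ψ) : volume (twistedW x i j ψ) = 1 := by
  obtain ⟨hirr, c, hc, hq⟩ := hbad
  have hbad' : ∀ q : ℕ, 0 < q → q • toT x ∉ box ![i, j] (c / q) := by
    intro q hq0 h
    have hq' : (0:ℝ) < q := by exact_mod_cast hq0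
    rw [← toT_nsmul, ← max_le_iff_box hi hj (by positivity)] at h
    exact absurd h (not_le.2 (hq q hq0))
  have hdiv' : ¬ Summable (fun r => min (ψ r) 1) := by
    intro hs
    apply hdiv
    have h1 := hs.tendsto_atTop_zero
    have h2 : ∀ᶠ r in atTop, min (ψ r) 1 < 1 := h1.eventually_lt_const one_pos
    refine (summable_congr_atTop ?_).1 hs
    filter_upwards [h2] with r hr
    rcases min_lt_iff.1 hr with h | h
    · exact min_eq_left h.le
    · exact absurd h (lt_irrefl _)
  obtain ⟨hWm, hW⟩ := limsup_full (e := ![i, j])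
    (by intro k; fin_cases k <;> simpa) (by simpa using hij) hirr hc hbad'
    (fun r => min (ψ r) 1) (fun r => lt_min (hψ r) one_pos) (fun r => min_le_right _ _)
    (fun a b h => min_le_min_right _ (hanti h)) hdiv'
  apply le_antisymm
  · calc volume (twistedW x i j ψ) ≤ volume (Set.Icc (0 : ℝ × ℝ) 1 ∩ toT ⁻¹' univ) :=
        measure_mono fun γ hγ => ⟨hγ.1, trivial⟩
      _ = 1 := by rw [volume_transfer MeasurableSet.univ, measure_univ]
  · rw [← hW, ← volume_transfer hWm]
    apply measure_mono
    rintro γ ⟨hγ, hg⟩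
    refine ⟨hγ, ?_⟩
    simp only [Set.mem_preimage, Set.mem_iInter, Set.mem_iUnion, Set.mem_Ioi] at hg
    have hinf : {q : ℕ | 0 < q ∧ toT γ ∈ bx ![i, j] (q • toT x) (min (ψ q) 1)}.Infinite := by
      rw [Set.infinite_iff_exists_gt]
      intro M
      obtain ⟨q, hq, h⟩ := hg M
      exact ⟨q, ⟨by omega, h⟩, hq⟩
    refine (hinf.image (f := fun q : ℕ => (q : ℤ)) (fun a _ b _ h => by simpa using h)).mono ?_
    rintro _ ⟨q, ⟨hq0, h⟩, rfl⟩
    refine ⟨by simpa using hq0.ne', ?_⟩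
    rw [max_le_iff_box hi hj (hψ _), toT_sub_zsmul]
    have h1 : q • toT x - toT γ ∈ box ![i, j] (min (ψ q) 1) := h
    intro k
    rw [natCast_zsmul, Int.natAbs_natCast]
    refine (h1 k).trans (Real.rpow_le_rpow (lt_min (hψ _) one_pos).le (min_le_left _ _) ?_)
    fin_cases k <;> simpa

lemma step {e : Fin 2 → ℝ} (he : ∀ k, 0 ≤ e k) (hsum : e 0 + e 1 = 1) (X : TT)
    (hnb : ∀ c : ℝ, 0 < c → ∃ q : ℕ, 0 < q ∧ q • X ∈ box e (c / q))
    (Q : ℕ) (ε' η : ℝ) (hε' : 0 < ε') (hη : 0 < η) :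
    ∃ Q' : ℕ, ∃ ε : ℝ, 0 < ε ∧ ε ≤ ε' ∧ Q ≤ Q' ∧ 1 ≤ ((Q' : ℝ) - Q) * ε ∧
      volume (⋃ m ∈ {m : ℤ | m.natAbs ≤ Q'}, bx e (m • X) ε) ≤ ENNReal.ofReal η := by
  set δ := min (η / 16) ε' with hδ
  have hδ0 : 0 < δ := lt_min (by positivity) hε'
  obtain ⟨N, hN⟩ := exists_nat_ge ((Q : ℝ) + 1 / δ)
  have hcex : ∃ c : ℝ, 0 < c ∧ ∀ k, 0 < e k → N * c ^ e k ≤ δ ^ e k := by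
    have h : ∀ᶠ c : ℝ in nhdsWithin 0 (Set.Ioi 0), ∀ k, 0 < e k → N * c ^ e k ≤ δ ^ e k := by
      rw [eventually_all]
      intro k
      by_cases hk : 0 < e k
      · have h1 : Tendsto (fun c : ℝ => (N : ℝ) * c ^ e k) (nhds 0) (nhds (N * 0 ^ e k)) :=
          ((Real.continuous_rpow_const hk.le).tendsto 0).const_mul _
        rw [Real.zero_rpow hk.ne', mul_zero] at h1
        have h2 := (h1.mono_left (nhdsWithin_le_nhds (s := Set.Ioi 0))).eventually_lt_const
          (Real.rpow_pos_of_pos hδ0 (e k))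
        filter_upwards [h2] with c hc _ using hc.le
      · exact Eventually.of_forall fun K h => absurd h hk
    obtain ⟨c, h1, h2⟩ := (h.and self_mem_nhdsWithin).exists
    exact ⟨c, h2, h1⟩
  obtain ⟨c, hc0, hc⟩ := hcex
  obtain ⟨q, hq0, hq⟩ := hnb c hc0
  have hq' : (1:ℝ) ≤ q := by exact_mod_cast hq0
  have hqp : (0:ℝ) < q := by linarith
  have hNQ : (Q:ℝ) ≤ N := by
    have : 0 < 1 / δ := by positivity
    linarith
  refine ⟨N * q, δ / q, by positivity, ?_, ?_, ?_, ?_⟩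
  · calc δ / q ≤ δ := div_le_self hδ0.le hq'
      _ ≤ ε' := min_le_right _ _
  · have : Q ≤ N := by exact_mod_cast hNQ
    exact this.trans (Nat.le_mul_of_pos_right _ hq0)
  · have h1 : 1 ≤ ((N:ℝ) - Q) * δ := by
      have : 1 / δ * δ ≤ ((N:ℝ) - Q) * δ := by gcongr; linarith
      rwa [one_div, inv_mul_cancel₀ hδ0.ne'] at this
    have h2 : (((N * q : ℕ) : ℝ) - Q) * (δ / q) = (N - Q / q) * δ := by
      push_cast; field_simp
    rw [h2]
    have h3 : (Q:ℝ) / q ≤ Q := div_le_self (by positivity) hq'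
    nlinarith
  · set r : Fin 2 → ℝ := fun k => 2 * (δ / q) ^ e k with hr
    have hcov : (⋃ m ∈ {m : ℤ | m.natAbs ≤ N * q}, bx e (m • X) (δ / q)) ⊆
        ⋃ a ∈ Finset.range q, Set.pi univ (fun k => Metric.closedBall ((a • X) k) (r k)) := by
      intro g hg
      simp only [Set.mem_iUnion] at hg ⊢
      obtain ⟨m, hm, hg⟩ := hg
      have hm' : m.natAbs ≤ N * q := hm
      have hqz : (0:ℤ) < q := by exact_mod_cast hq0
      have ha0 : 0 ≤ m % q := Int.emod_nonneg _ hqz.ne'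
      have ha1 : m % q < q := Int.emod_lt_of_pos _ hqz
      obtain ⟨a, ha⟩ := Int.eq_ofNat_of_zero_le ha0
      refine ⟨a, by rw [Finset.mem_range]; omega, ?_⟩
      have hdm := Int.emod_add_mul_ediv m q
      set b := m / (q:ℤ) with hb
      have hbN : |b| ≤ (N : ℤ) := by
        have h1 : |m| ≤ (N:ℤ) * q := by rw [Int.abs_eq_natAbs]; exact_mod_cast hm'
        rw [abs_le] at h1 ⊢
        constructor
        · rw [hb, Int.le_ediv_iff_mul_le hqz]; linarith
        · rw [hb]
          apply Int.ediv_le_of_le_mul hqz; linarith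
      intro k _
      rw [Metric.mem_closedBall, dist_eq_norm, norm_sub_rev]
      rcases (he k).eq_or_lt with h | h
      · simp only [hr, ← h, Real.rpow_zero]
        linarith [norm_le_half ((a • X) k - g k)]
      · have hX : m • X = a • X + b • (q • X) := by
          rw [← hdm, ha, add_zsmul, mul_comm, mul_zsmul]
          simp
        have h1 : ‖(m • X - g) k‖ ≤ (δ / q) ^ e k := hg k
        have h2 : ‖(q • X) k‖ ≤ (c / q) ^ e k := hq k
        have h3 : (a • X) k - g k = (m • X - g) k - b • ((q • X) k) := by
          rw [hX]; simp only [Pi.sub_apply, Pi.add_apply, Pi.smul_apply]; abel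
        have h4 : ‖b • ((q • X) k)‖ ≤ N * (c / q) ^ e k := by
          refine (norm_zsmul_le _ _).trans ?_
          have : ‖b‖ ≤ N := by
            rw [Int.norm_eq_abs]; exact_mod_cast hbN
          gcongr
        have h5 : N * (c / q) ^ e k ≤ (δ / q) ^ e k := by
          rw [Real.div_rpow hc0.le hqp.le, Real.div_rpow hδ0.le hqp.le, ← mul_div_assoc]
          gcongr
          exact hc k h
        rw [h3]
        calc _ ≤ ‖(m • X - g) k‖ + ‖b • ((q • X) k)‖ := norm_sub_le _ _
          _ ≤ 2 * (δ / q) ^ e k := by linarith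
    have hone : ∀ a : ℕ, volume (Set.pi univ
        (fun k => Metric.closedBall ((a • X) k) (r k))) ≤ ENNReal.ofReal (16 * (δ / q)) := by
      intro a
      have hεp : 0 < δ / q := by positivity
      have := pi_ball_real r (fun k => by positivity) (a • X)
      rw [← ENNReal.ofReal_toReal (measure_ne_top volume (Set.pi univ
        (fun k => Metric.closedBall ((a • X) k) (r k))))]
      apply ENNReal.ofReal_le_ofReal
      rw [Measure.real] at this
      rw [this]
      have h1 : (δ / q) ^ e 0 * (δ / q) ^ e 1 = δ / q := by
        rw [← Real.rpow_add hεp, hsum, Real.rpow_one]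
      calc _ ≤ (2 * r 0) * (2 * r 1) := by
            gcongr
            · exact min_le_right _ _
            · exact min_le_right _ _
        _ = 16 * (δ / q) := by simp only [hr]; linear_combination 16 * h1
    calc _ ≤ volume (⋃ a ∈ Finset.range q,
          Set.pi univ (fun k => Metric.closedBall ((a • X) k) (r k))) := measure_mono hcov
      _ ≤ ∑ a ∈ Finset.range q, volume (Set.pi univ
          (fun k => Metric.closedBall ((a • X) k) (r k))) := measure_biUnion_finset_le _ _
      _ ≤ ∑ a ∈ Finset.range q, ENNReal.ofReal (16 * (δ / q)) :=
          Finset.sum_le_sum fun a _ => hone a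
      _ = ENNReal.ofReal (16 * δ) := by
          rw [Finset.sum_const, Finset.card_range, nsmul_eq_mul,
            ← ENNReal.ofReal_natCast, ← ENNReal.ofReal_mul (by positivity)]
          congr 1; field_simp
      _ ≤ ENNReal.ofReal η := by
          apply ENNReal.ofReal_le_ofReal
          have : δ ≤ η / 16 := min_le_left _ _
          linarith

lemma exists_psi {e : Fin 2 → ℝ} (he : ∀ k, 0 ≤ e k) (hsum : e 0 + e 1 = 1) (X : TT)
    (hnb : ∀ c : ℝ, 0 < c → ∃ q : ℕ, 0 < q ∧ q • X ∈ box e (c / q)) :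
    ∃ ψ : ℕ → ℝ, (∀ r, 0 < ψ r) ∧ Antitone ψ ∧ ¬ Summable ψ ∧
      volume (⋃ m : ℤ, bx e (m • X) (ψ m.natAbs)) < 1 := by
  have hstep := fun (p : ℕ × {t : ℝ // 0 < t}) (k : ℕ) =>
    step he hsum X hnb p.1 p.2.1 ((1 / 2) ^ (k + 2)) p.2.2 (by positivity)
  choose Qf εf h1 h2 h3 h4 h5 using hstep
  let S : ℕ → ℕ × {t : ℝ // 0 < t} := fun k =>
    Nat.rec (0, ⟨1, one_pos⟩) (fun k p => (Qf p k, ⟨εf p k, h1 p k⟩)) k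
  let Q : ℕ → ℕ := fun k => (S k).1
  let ε : ℕ → ℝ := fun k => (S k).2.1
  have hε0 : ∀ k, 0 < ε k := fun k => (S k).2.2
  have g2 : ∀ k, ε (k + 1) ≤ ε k := fun k => h2 (S k) k
  have g3 : ∀ k, Q k ≤ Q (k + 1) := fun k => h3 (S k) k
  have g4 : ∀ k, 1 ≤ ((Q (k + 1) : ℝ) - Q k) * ε (k + 1) := fun k => h4 (S k) k
  have g5 : ∀ k, volume (⋃ m ∈ {m : ℤ | m.natAbs ≤ Q (k + 1)}, bx e (m • X) (ε (k + 1)))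
      ≤ ENNReal.ofReal ((1 / 2) ^ (k + 2)) := fun k => h5 (S k) k
  have hQ0 : Q 0 = 0 := rfl
  have hεanti : Antitone ε := antitone_nat_of_succ_le g2
  clear_value ε Q
  have hQlt : ∀ k, Q k < Q (k + 1) := by
    intro k
    refine lt_of_le_of_ne (g3 k) fun h => ?_
    have := g4 k
    rw [← h, sub_self, zero_mul] at this
    linarith
  have hQmono : StrictMono Q := strictMono_nat_of_lt_succ hQlt
  have hex : ∀ r : ℕ, ∃ k, r ≤ Q (k + 1) := fun r =>
    ⟨r, (hQmono.le_apply (x := r)).trans (g3 r)⟩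
  classical
  let ψ : ℕ → ℝ := fun r => ε (Nat.find (hex r) + 1)
  have hψ : ∀ r, 0 < ψ r := fun r => hε0 (Nat.find (hex r) + 1)
  refine ⟨ψ, hψ, ?_, ?_, ?_⟩
  · intro r r' h
    show ε (Nat.find (hex r') + 1) ≤ ε (Nat.find (hex r) + 1)
    apply hεanti
    have : Nat.find (hex r) ≤ Nat.find (hex r') :=
      Nat.find_min' _ (h.trans (Nat.find_spec (hex r')))
    omega
  · intro hs
    have hpart : ∀ k : ℕ, (k : ℝ) ≤ ∑ r ∈ Finset.range (Q k + 1), ψ r := by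
      intro k
      induction k with
      | zero => simpa [hQ0] using (hψ 0).le
      | succ k ih =>
        rw [← Finset.sum_range_add_sum_Ico ψ (show Q k + 1 ≤ Q (k + 1) + 1 by
          have := g3 k; omega)]
        have : 1 ≤ ∑ r ∈ Finset.Ico (Q k + 1) (Q (k + 1) + 1), ψ r := by
          calc (1:ℝ) ≤ ((Q (k + 1) : ℝ) - Q k) * ε (k + 1) := g4 k
            _ = ∑ r ∈ Finset.Ico (Q k + 1) (Q (k + 1) + 1), ε (k + 1) := by
              rw [Finset.sum_const, Nat.card_Ico, nsmul_eq_mul, ← Nat.cast_sub (g3 k)]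
              congr 2; omega
            _ ≤ _ := by
              refine Finset.sum_le_sum fun r hr => ?_
              show ε (k + 1) ≤ ε (Nat.find (hex r) + 1)
              apply hεanti
              rw [Finset.mem_Ico] at hr
              have : Nat.find (hex r) ≤ k := Nat.find_min' _ (by omega)
              omega
        push_cast
        linarith
    obtain ⟨k, hk⟩ := exists_nat_gt (∑' r, ψ r)
    have := hs.sum_le_tsum (Finset.range (Q k + 1)) (fun r _ => (hψ r).le)
    linarith [hpart k]
  · have hsub : (⋃ m : ℤ, bx e (m • X) (ψ m.natAbs)) ⊆
        ⋃ k, ⋃ m ∈ {m : ℤ | m.natAbs ≤ Q (k + 1)}, bx e (m • X) (ε (k + 1)) := by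
      apply Set.iUnion_subset
      intro m g hg
      rw [Set.mem_iUnion]
      exact ⟨Nat.find (hex m.natAbs), Set.mem_biUnion (x := m) (Nat.find_spec (hex m.natAbs)) hg⟩
    have hgeo : HasSum (fun k : ℕ => (1 / 2 : ℝ) ^ (k + 2)) (1 / 2) := by
      have := hasSum_geometric_two.mul_right ((1 / 2 : ℝ) ^ 2)
      have h1 : (fun k : ℕ => (1 / 2 : ℝ) ^ (k + 2)) = fun k => (1 / 2 : ℝ) ^ k * (1 / 2) ^ 2 := by
        funext k; rw [pow_add]
      have h2 : (1 / 2 : ℝ) = 2 * (1 / 2) ^ 2 := by norm_num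
      rw [h1]
      rwa [← h2] at this
    calc _ ≤ volume (⋃ k, ⋃ m ∈ {m : ℤ | m.natAbs ≤ Q (k + 1)}, bx e (m • X) (ε (k + 1))) :=
          measure_mono hsub
      _ ≤ ∑' k, volume (⋃ m ∈ {m : ℤ | m.natAbs ≤ Q (k + 1)}, bx e (m • X) (ε (k + 1))) :=
          measure_iUnion_le _
      _ ≤ ∑' k : ℕ, ENNReal.ofReal ((1 / 2 : ℝ) ^ (k + 2)) := ENNReal.tsum_le_tsum g5
      _ = ENNReal.ofReal (1 / 2) := by
          rw [← ENNReal.ofReal_tsum_of_nonneg (fun k => by positivity) hgeo.summable,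
            hgeo.tsum_eq]
      _ < 1 := by rw [ENNReal.ofReal_lt_one]; norm_num

lemma dir2 {i j : ℝ} (hi : 0 ≤ i) (hj : 0 ≤ j) (hij : i + j = 1)
    {x : ℝ × ℝ} (hirr : IrrVec x) (h : ∀ ψ : ℕ → ℝ, (∀ r, 0 < ψ r) → Antitone ψ → ¬ Summable ψ →
      volume (twistedW x i j ψ) = 1) : Badij i j x := by
  by_contra hnb
  have hnb' : ∀ c : ℝ, 0 < c → ∃ q : ℕ, 0 < q ∧ q • toT x ∈ box ![i, j] (c / q) := by
    intro c hc
    by_contra! hno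
    refine hnb ⟨hirr, c, hc, fun q hq => ?_⟩
    have hq' : (0:ℝ) < q := by exact_mod_cast hq
    by_contra hle
    rw [gt_iff_lt, not_lt, max_le_iff_box hi hj (by positivity), toT_nsmul] at hle
    exact hno q hq hle
  obtain ⟨ψ, hψ, hanti, hdiv, hlt⟩ := exists_psi (e := ![i, j])
    (by intro k; fin_cases k <;> simpa) (by simpa using hij) (toT x) hnb'
  have h1 := h ψ hψ hanti hdiv
  rw [← volume_transfer (MeasurableSet.iUnion fun m => measurableSet_bx _ _ _)] at hlt
  refine absurd h1 (ne_of_lt (lt_of_le_of_lt (measure_mono ?_) hlt))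
  rintro γ ⟨hγ, hinf⟩
  refine ⟨hγ, ?_⟩
  obtain ⟨q, _, hq⟩ := hinf.nonempty
  rw [max_le_iff_box hi hj (hψ _), toT_sub_zsmul] at hq
  rw [Set.mem_preimage, Set.mem_iUnion]
  exact ⟨q, hq⟩

theorem stmt12 (i j : ℝ) (hi : 0 ≤ i) (hj : 0 ≤ j) (hij : i + j = 1)
    (x : ℝ × ℝ) (hirr : IrrVec x) :
    (∀ ψ : ℕ → ℝ, (∀ r, 0 < ψ r) → Antitone ψ → ¬ Summable ψ →
      volume (twistedW x i j ψ) = 1) ↔ Badij i j x := by 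
  exact ⟨fun h => dir2 hi hj hij hirr h,
    fun h ψ hψ hanti hdiv => dir1 hi hj hij h ψ hψ hanti hdiv⟩
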